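/- Let $s_0, \dots, s_J \in \mathbb{C}$ be distinct support points, $w_0, \dots, w_J \in \mathbb{C}$ weights, and $f_0, \dots, f_J \in \mathbb{C}$ values, and define $N(z) = \sum_{j=0}^{J} f_j w_j/(z - s_j)$. Let $E_f$ be the $(J+2)\times(J+2)$ complex matrix whose $(0,0)$ entry is $0$, whose remaining first-row entries are $(E_f)_{0,j+1} = f_j w_j$, whose remaining first-column entries are $(E_f)_{j+1,0} = 1$, whose diagonal entries are $(E_f)_{j+1,j+1} = s_j$, and all other entries zero; and let $B$ be the diagonal matrix with $B_{0,0} = 0$ and $B_{j+1,j+1} = 1$ for $j = 0,\dots,J$. Then for every $\lambda \notin \{s_0,\dots,s_J\}$, $\det(\lambda B - E_f) = -\Big(\prod_{j=0}^{J}(\lambda - s_j)\Big) N(\lambda)$; consequently the zeros of the barycentric rational function $r = N/D$ lying outside the support set are exactly the generalized eigenvalues of the pencil $(E_f, B)$ that avoid the support points. -/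

import Mathlib

open Finset Matrix

/-- The determinant of an arrowhead matrix with invertible diagonal block, by its Schur complement. -/
theorem Matrix.det_arrowhead {K : Type*} [Field K] {n : ℕ}
    (M : Matrix (Fin (n + 1)) (Fin (n + 1)) K) (d : Fin n → K) (hd : ∀ j, d j ≠ 0)
    (hM : ∀ i j : Fin n, M i.succ j.succ = if i = j then d j else 0) :
    M.det = (∏ j, d j) * (M 0 0 - ∑ j, M 0 j.succ * M j.succ 0 / d j) := by
  let e : Fin n ⊕ PUnit.{1} ≃ Fin (n + 1) :=
    ((finSuccEquiv n).trans (Equiv.optionEquivSumPUnit (Fin n))).symm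
  have hblocks : M.submatrix e e = Matrix.fromBlocks (Matrix.diagonal d)
      (Matrix.of fun i _ => M i.succ 0) (Matrix.of fun _ j => M 0 j.succ)
      (Matrix.of fun _ _ => M 0 0) := by
    ext (i | i) (j | j)
    · by_cases h : i = j <;> simp [e, hM, h]
    all_goals simp [e]
  have hmul : Matrix.diagonal d * Matrix.diagonal (fun j => (d j)⁻¹) = 1 := by
    simp [Matrix.diagonal_mul_diagonal, hd]
  let _ : Invertible (Matrix.diagonal d) := invertibleOfRightInverse _ _ hmul
  have hinv : ⅟(Matrix.diagonal d) = Matrix.diagonal (fun j => (d j)⁻¹) :=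
    invOf_eq_right_inv hmul
  rw [← Matrix.det_submatrix_equiv_self e, hblocks, Matrix.det_fromBlocks₁₁, hinv,
    Matrix.det_diagonal, Matrix.det_unique]
  congr 1
  simp only [Matrix.sub_apply, Matrix.of_apply, Matrix.mul_apply (N := Matrix.of _),
    Matrix.mul_diagonal]
  congr 1
  exact Finset.sum_congr rfl fun j _ => by ring

/-- The zeros of the barycentric rational function `r = N/D` lying outside the
support set (i.e. the zeros of `N(λ) = ∑ f j * w j / (λ - s j)`) are exactly the
generalized eigenvalues of the pencil `(E_f, B)`, where `E_f` has first row
`(0, f₀w₀, …, f_Jw_J)`, first column `(0, 1, …, 1)ᵀ`, and diagonal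
`(0, s₀, …, s_J)`, and `B = diag(0, 1, …, 1)`:
`det(λB - E_f) = -(∏ j (λ - s j)) · N(λ)` for `λ` outside the support set. -/
theorem barycentric_zeros_generalized_eigenvalues (J : ℕ)
    (s w f : Fin (J + 1) → ℂ)
    (Ef B : Matrix (Fin (J + 2)) (Fin (J + 2)) ℂ)
    (hEf : Ef = Matrix.of fun i k =>
      Fin.cases (motive := fun _ => ℂ)
        (Fin.cases (motive := fun _ => ℂ) 0 (fun j => f j * w j) k)
        (fun j' => Fin.cases (motive := fun _ => ℂ) 1
          (fun j => if j' = j then s j else 0) k) i)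
    (hB : B = Matrix.diagonal
      (Fin.cases (motive := fun _ => ℂ) 0 (fun _ => 1))) :
    ∀ lam : ℂ, (∀ j, lam ≠ s j) →
      (lam • B - Ef).det
          = -(∏ j, (lam - s j)) * (∑ j, f j * w j / (lam - s j)) ∧
      ((∑ j, f j * w j / (lam - s j)) = 0 ↔ (lam • B - Ef).det = 0) := by
  subst hEf hB
  intro lam hlam
  have hne : ∀ j, lam - s j ≠ 0 := fun j => sub_ne_zero.mpr (hlam j)
  rw [Matrix.det_arrowhead _ (fun j => lam - s j) hne ?_]
  · have hprod : ∏ j, (lam - s j) ≠ 0 := Finset.prod_ne_zero_iff.mpr fun j _ => hne j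
    simp [hprod, Matrix.diagonal_apply_ne _ (Fin.succ_ne_zero _).symm]
  · intro i j
    by_cases h : i = j <;> simp [h]
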